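/- arXiv:0712.3093 — 3 statements merged into one kernel-verified Lean document; each statement's English description precedes it below -/
import Mathlib

section
/- Let n ≥ 1. For every pair of functions f, g in the complex linear span of {TS_k : k ∈ Λ_n°}, one has ⟨f, g⟩_Δ = (2/n²) Σ_{j ∈ Λ_n°} f(j/n) conj(g(j/n)), where j/n = (j₁/n, j₂/n, j₃/n). -/
open MeasureTheory
open scoped Real Classical

noncomputable section

/-- `φ_j(t) = exp(2πi (j₁t₁ + j₂t₂ + j₃t₃)/3)` for `j ∈ ℤ³`, `t ∈ ℝ³`. -/
def phi (j : ℤ × ℤ × ℤ) (t : ℝ × ℝ × ℝ) : ℂ :=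
  Complex.exp (2 * (Real.pi : ℂ) * Complex.I *
    ((j.1 : ℂ) * (t.1 : ℂ) + (j.2.1 : ℂ) * (t.2.1 : ℂ) + (j.2.2 : ℂ) * (t.2.2 : ℂ)) / 3)

/-- The generalized cosine `TC_k`. -/
def TCos (k : ℤ × ℤ × ℤ) (t : ℝ × ℝ × ℝ) : ℂ :=
  (1 / 6) * (phi k t + phi (k.2.1, k.2.2, k.1) t + phi (k.2.2, k.1, k.2.1) t +
    phi (-k.1, -k.2.2, -k.2.1) t + phi (-k.2.1, -k.1, -k.2.2) t +
    phi (-k.2.2, -k.2.1, -k.1) t)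

/-- The generalized sine `TS_k`. -/
def TSin (k : ℤ × ℤ × ℤ) (t : ℝ × ℝ × ℝ) : ℂ :=
  (1 / (6 * Complex.I)) * (phi k t + phi (k.2.1, k.2.2, k.1) t + phi (k.2.2, k.1, k.2.1) t -
    phi (-k.1, -k.2.2, -k.2.1) t - phi (-k.2.1, -k.1, -k.2.2) t -
    phi (-k.2.2, -k.2.1, -k.1) t)

/-- The point `j/n = (j₁/n, j₂/n, j₃/n)`. -/
def pt (n : ℕ) (j : ℤ × ℤ × ℤ) : ℝ × ℝ × ℝ :=
  ((j.1 : ℝ) / n, (j.2.1 : ℝ) / n, (j.2.2 : ℝ) / n)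

/-- The triangle `Δ = {(t₁,t₂) : t₁ ≥ 0, t₂ ≥ 0, t₁+t₂ ≤ 1}`. -/
def TriDelta : Set (ℝ × ℝ) := {p | 0 ≤ p.1 ∧ 0 ≤ p.2 ∧ p.1 + p.2 ≤ 1}

/-- Embedding `(t₁,t₂) ↦ (t₁,t₂,-t₁-t₂)` into the plane `t₁+t₂+t₃=0`. -/
def emb (p : ℝ × ℝ) : ℝ × ℝ × ℝ := (p.1, p.2, -p.1 - p.2)

/-- `⟨f,g⟩_Δ = 2 ∫_Δ f(t₁,t₂,-t₁-t₂) conj(g(t₁,t₂,-t₁-t₂)) dt₁dt₂`. -/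
def innerD (f g : ℝ × ℝ × ℝ → ℂ) : ℂ :=
  2 * ∫ p in TriDelta, f (emb p) * (starRingEnd ℂ) (g (emb p))

/-- `Λ = {k ∈ ℍ : k₁ ≥ 0, k₂ ≥ 0, k₃ ≤ 0}`. -/
def Lam : Set (ℤ × ℤ × ℤ) :=
  {k | k.1 + k.2.1 + k.2.2 = 0 ∧ 0 ≤ k.1 ∧ 0 ≤ k.2.1 ∧ k.2.2 ≤ 0}

/-- `Λ° = {k ∈ Λ : k₁ > 0, k₂ > 0, k₃ < 0}`. -/
def LamCirc : Set (ℤ × ℤ × ℤ) :=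
  {k | k.1 + k.2.1 + k.2.2 = 0 ∧ 0 < k.1 ∧ 0 < k.2.1 ∧ k.2.2 < 0}

/-- `Λ_n = {k ∈ Λ : -k₃ ≤ n}`. -/
def Lamn (n : ℕ) : Set (ℤ × ℤ × ℤ) :=
  {k | k.1 + k.2.1 + k.2.2 = 0 ∧ 0 ≤ k.1 ∧ 0 ≤ k.2.1 ∧ -k.2.2 ≤ (n : ℤ)}

/-- `Λ_n° = {k ∈ Λ_n : k₁ > 0, k₂ > 0, -k₃ < n}`. -/
def LamnCirc (n : ℕ) : Set (ℤ × ℤ × ℤ) :=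
  {k | k.1 + k.2.1 + k.2.2 = 0 ∧ 0 < k.1 ∧ 0 < k.2.1 ∧ -k.2.2 < (n : ℤ)}

/-- Weights `λ_j^{(n)}`: 6 on interior points, 1 on the three vertices, 3 on edge points. -/
def lamwt (n : ℕ) (j : ℤ × ℤ × ℤ) : ℝ :=
  if 0 < j.1 ∧ 0 < j.2.1 ∧ -j.2.2 < (n : ℤ) then 6
  else if j = ((n : ℤ), 0, -(n : ℤ)) ∨ j = (0, (n : ℤ), -(n : ℤ)) ∨ j = (0, 0, 0) then 1
  else 3

/-- Reflection of the plane in the wall `x = 0`. -/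
def reflOne (p : ℝ × ℝ) : ℝ × ℝ := (-p.1, p.1 + p.2)

/-- Reflection of the plane in the wall `y = 0`. -/
def reflTwo (p : ℝ × ℝ) : ℝ × ℝ := (p.1 + p.2, -p.2)

/-- Reflection of the plane in the wall `x + y = 1`. -/
def reflThree (p : ℝ × ℝ) : ℝ × ℝ := (1 - p.2, 1 - p.1)

/-- Functions changing sign under the three reflections in the sides of the triangle. -/
structure IsAlternating (u : ℝ × ℝ → ℂ) : Prop where
  one : ∀ p, u (reflOne p) = -u p
  two : ∀ p, u (reflTwo p) = -u p
  three : ∀ p, u (reflThree p) = -u p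

/-- Functions invariant under the three reflections in the sides of the triangle and vanishing on
the sides. -/
structure IsFoldable (F : ℝ × ℝ → ℂ) : Prop where
  one : ∀ p, F (reflOne p) = F p
  two : ∀ p, F (reflTwo p) = F p
  three : ∀ p, F (reflThree p) = F p
  left : ∀ p : ℝ × ℝ, p.1 = 0 → F p = 0
  bottom : ∀ p : ℝ × ℝ, p.2 = 0 → F p = 0
  diagonal : ∀ p : ℝ × ℝ, p.1 + p.2 = 1 → F p = 0

/-- The strip `[0,3) × [0,1)`, made of six images of the triangle. -/
def strip : Set (ℝ × ℝ) := Set.Ico 0 3 ×ˢ Set.Ico 0 1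

lemma IsAlternating.isFoldable_mul_conj {u v : ℝ × ℝ → ℂ} (hu : IsAlternating u)
    (hv : IsAlternating v) : IsFoldable fun p => u p * (starRingEnd ℂ) (v p) where
  one p := by simp [hu.one, hv.one]
  two p := by simp [hu.two, hv.two]
  three p := by simp [hu.three, hv.three]
  left p hp := by
    have h := hu.one p
    rw [show reflOne p = p by ext <;> simp [reflOne, hp], self_eq_neg] at h
    simp [h]
  bottom p hp := by
    have h := hu.two p
    rw [show reflTwo p = p by ext <;> simp [reflTwo, hp], self_eq_neg] at h
    simp [h]
  diagonal p hp := by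
    have h := hu.three p
    rw [show reflThree p = p by ext <;> simp [reflThree] <;> linarith, self_eq_neg] at h
    simp [h]

/-- The strip is tiled by the images of the triangle under successive reflections. -/
lemma IsFoldable.indicator_strip {F : ℝ × ℝ → ℂ} (hF : IsFoldable F) :
    strip.indicator F =
      TriDelta.indicator F + TriDelta.indicator F ∘ reflThree +
        TriDelta.indicator F ∘ reflTwo ∘ reflThree +
        TriDelta.indicator F ∘ reflOne ∘ reflTwo ∘ reflThree +
        TriDelta.indicator F ∘ reflThree ∘ reflOne ∘ reflTwo ∘ reflThree +
        TriDelta.indicator F ∘ reflTwo ∘ reflThree ∘ reflOne ∘ reflTwo ∘ reflThree := by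
  funext p
  simp only [Pi.add_apply, Function.comp_apply, Set.indicator_apply, hF.one, hF.two, hF.three]
  by_cases h0 : F p = 0
  · simp [h0]
  have b0 := mt (hF.left p) h0
  have b1 := mt (hF.bottom p) h0
  have b2 := mt (hF.diagonal p) h0
  have b3 := mt (hF.left (reflThree p)) (by rwa [hF.three])
  have b4 := mt (hF.bottom (reflThree p)) (by rwa [hF.three])
  have b5 := mt (hF.left (reflTwo (reflThree p))) (by rwa [hF.two, hF.three])
  have b6 := mt (hF.diagonal (reflOne (reflTwo (reflThree p))))
    (by rwa [hF.one, hF.two, hF.three])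
  have b7 := mt (hF.bottom (reflThree (reflOne (reflTwo (reflThree p)))))
    (by rwa [hF.three, hF.one, hF.two, hF.three])
  have b8 := mt (hF.left (reflTwo (reflThree (reflOne (reflTwo (reflThree p))))))
    (by rwa [hF.two, hF.three, hF.one, hF.two, hF.three])
  obtain ⟨x, y⟩ := p
  simp only [reflOne, reflTwo, reflThree] at b0 b1 b2 b3 b4 b5 b6 b7 b8
  have c1 : x ≠ 1 := fun h => b4 (by linarith)
  have c2 : x ≠ 2 := fun h => b6 (by linarith)
  have c3 : x ≠ 3 := fun h => b8 (by linarith)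
  have d1 : y ≠ 1 := fun h => b3 (by linarith)
  have s2 : x + y ≠ 2 := fun h => b5 (by linarith)
  have s3 : x + y ≠ 3 := fun h => b7 (by linarith)
  have m0 : (x, y) ∈ TriDelta ↔ 0 < x ∧ 0 < y ∧ x + y < 1 :=
    ⟨fun ⟨h1, h2, h3⟩ => ⟨lt_of_le_of_ne h1 (Ne.symm b0), lt_of_le_of_ne h2 (Ne.symm b1),
      lt_of_le_of_ne h3 b2⟩, fun ⟨h1, h2, h3⟩ => ⟨h1.le, h2.le, h3.le⟩⟩
  have m1 : reflThree (x, y) ∈ TriDelta ↔ x < 1 ∧ y < 1 ∧ 1 < x + y := by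
    simp only [TriDelta, reflThree, Set.mem_ofPred_eq]
    grind
  have m2 : reflTwo (reflThree (x, y)) ∈ TriDelta ↔ 1 < x ∧ 0 < y ∧ x + y < 2 := by
    simp only [TriDelta, reflTwo, reflThree, Set.mem_ofPred_eq]
    grind
  have m3 : reflOne (reflTwo (reflThree (x, y))) ∈ TriDelta ↔ x < 2 ∧ y < 1 ∧ 2 < x + y := by
    simp only [TriDelta, reflOne, reflTwo, reflThree, Set.mem_ofPred_eq]
    grind
  have m4 : reflThree (reflOne (reflTwo (reflThree (x, y)))) ∈ TriDelta ↔
      2 < x ∧ 0 < y ∧ x + y < 3 := by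
    simp only [TriDelta, reflOne, reflTwo, reflThree, Set.mem_ofPred_eq]
    grind
  have m5 : reflTwo (reflThree (reflOne (reflTwo (reflThree (x, y))))) ∈ TriDelta ↔
      x < 3 ∧ y < 1 ∧ 3 < x + y := by
    simp only [TriDelta, reflOne, reflTwo, reflThree, Set.mem_ofPred_eq]
    grind
  have m : (x, y) ∈ strip ↔ 0 < x ∧ x < 3 ∧ 0 < y ∧ y < 1 := by
    simp only [strip, Set.mem_prod, Set.mem_Ico]
    grind
  simp only [m, m0, m1, m2, m3, m4, m5]
  clear m m0 m1 m2 m3 m4 m5 b3 b4 b5 b6 b7 b8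
  have key : ∀ {a b : ℝ}, a ≠ b → a < b ∧ ¬b < a ∨ b < a ∧ ¬a < b := fun {a b} h =>
    (lt_or_gt_of_ne h).imp (fun h => ⟨h, h.not_gt⟩) (fun h => ⟨h, h.not_gt⟩)
  rcases key b1 with ⟨_, _⟩ | ⟨_, _⟩ <;> rcases key d1 with ⟨_, _⟩ | ⟨_, _⟩ <;>
    try (exfalso; linarith)
  all_goals rcases key b0 with ⟨_, _⟩ | ⟨_, _⟩ <;> rcases key c1 with ⟨_, _⟩ | ⟨_, _⟩ <;>
    try (exfalso; linarith)
  all_goals rcases key c2 with ⟨_, _⟩ | ⟨_, _⟩ <;> rcases key c3 with ⟨_, _⟩ | ⟨_, _⟩ <;>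
    try (exfalso; linarith)
  all_goals rcases key b2 with ⟨_, _⟩ | ⟨_, _⟩ <;> rcases key s2 with ⟨_, _⟩ | ⟨_, _⟩ <;>
    try (exfalso; linarith)
  all_goals rcases key s3 with ⟨_, _⟩ | ⟨_, _⟩ <;> try (exfalso; linarith)
  all_goals simp only [*, and_true, and_false, if_true, if_false, add_zero,
    zero_add]

/-- If a functional is invariant under the three reflections and additive on a class of functions,
then its value on the strip is six times its value on the triangle. -/
lemma IsFoldable.strip_eq_six_mul {F : ℝ × ℝ → ℂ} (hF : IsFoldable F)
    (L : (ℝ × ℝ → ℂ) → ℂ) (P : (ℝ × ℝ → ℂ) → Prop)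
    (L_one : ∀ G, L (G ∘ reflOne) = L G) (L_two : ∀ G, L (G ∘ reflTwo) = L G)
    (L_three : ∀ G, L (G ∘ reflThree) = L G)
    (P_one : ∀ G, P G → P (G ∘ reflOne)) (P_two : ∀ G, P G → P (G ∘ reflTwo))
    (P_three : ∀ G, P G → P (G ∘ reflThree)) (P_add : ∀ G H, P G → P H → P (G + H))
    (L_add : ∀ G H, P G → P H → L (G + H) = L G + L H) (hP : P (TriDelta.indicator F)) :
    L (strip.indicator F) = 6 * L (TriDelta.indicator F) := by
  rw [hF.indicator_strip]
  set G := TriDelta.indicator F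
  have p1 : P (G ∘ reflThree) := P_three _ hP
  have p2 : P (G ∘ reflTwo ∘ reflThree) := P_three _ (P_two _ hP)
  have p3 : P (G ∘ reflOne ∘ reflTwo ∘ reflThree) := P_three _ (P_two _ (P_one _ hP))
  have p4 : P (G ∘ reflThree ∘ reflOne ∘ reflTwo ∘ reflThree) :=
    P_three _ (P_two _ (P_one _ (P_three _ hP)))
  have p5 : P (G ∘ reflTwo ∘ reflThree ∘ reflOne ∘ reflTwo ∘ reflThree) :=
    P_three _ (P_two _ (P_one _ (P_three _ (P_two _ hP))))
  have q1 := P_add _ _ hP p1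
  have q2 := P_add _ _ q1 p2
  have q3 := P_add _ _ q2 p3
  have q4 := P_add _ _ q3 p4
  rw [L_add _ _ q4 p5, L_add _ _ q3 p4, L_add _ _ q2 p3, L_add _ _ q1 p2, L_add _ _ hP p1]
  simp only [← Function.comp_assoc, L_one, L_two, L_three]
  ring

lemma reflOne_involutive : Function.Involutive reflOne := fun p => by
  ext <;> simp [reflOne]

lemma reflTwo_involutive : Function.Involutive reflTwo := fun p => by
  ext <;> simp [reflTwo]

lemma reflThree_involutive : Function.Involutive reflThree := fun p => by
  ext <;> simp [reflThree]

lemma measurePreserving_reflOne : MeasurePreserving reflOne := by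
  have h : MeasurePreserving (fun p : ℝ × ℝ => (-p.1, p.2)) :=
    (Measure.measurePreserving_neg volume).prod (MeasurePreserving.id volume)
  exact h.comp (measurePreserving_prod_add volume volume)

lemma measurePreserving_neg_swap : MeasurePreserving fun p : ℝ × ℝ => (-p.2, -p.1) := by
  have h : MeasurePreserving (fun p : ℝ × ℝ => (-p.1, -p.2)) :=
    (Measure.measurePreserving_neg volume).prod (Measure.measurePreserving_neg volume)
  exact h.comp Measure.measurePreserving_swap

lemma measurePreserving_reflTwo : MeasurePreserving reflTwo := by
  convert (measurePreserving_neg_swap.comp measurePreserving_reflOne).comp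
    measurePreserving_neg_swap using 1
  funext p
  ext <;> simp [reflOne, reflTwo]

lemma measurePreserving_reflThree : MeasurePreserving reflThree := by
  have h : reflThree = (fun p => (1, 1) + p) ∘ fun p : ℝ × ℝ => (-p.2, -p.1) := by
    funext p
    ext <;> simp [reflThree, sub_eq_add_neg]
  rw [h]
  exact (measurePreserving_add_left (volume : Measure (ℝ × ℝ)) (1, 1)).comp
    measurePreserving_neg_swap

lemma integral_comp_of_involutive {r : ℝ × ℝ → ℝ × ℝ} (hr : MeasurePreserving r)
    (hi : Function.Involutive r) (G : ℝ × ℝ → ℂ) : ∫ p, (G ∘ r) p = ∫ p, G p :=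
  hr.integral_comp (hr.measurable.measurableEmbedding hi.injective) G

lemma measurableSet_triDelta : MeasurableSet TriDelta := by
  unfold TriDelta
  measurability

lemma isBounded_triDelta : Bornology.IsBounded TriDelta := by
  refine (Metric.isBounded_Icc (0 : ℝ × ℝ) 1).subset ?_
  rintro ⟨x, y⟩ ⟨h1, h2, h3⟩
  simp only at h1 h2 h3
  exact ⟨⟨h1, h2⟩, ⟨by simp; linarith, by simp; linarith⟩⟩

lemma integrableOn_of_isBounded {F : ℝ × ℝ → ℂ} (hF : Continuous F) {s : Set (ℝ × ℝ)}
    (hs : Bornology.IsBounded s) : IntegrableOn F s :=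
  (hF.continuousOn.integrableOn_compact hs.isCompact_closure).mono_set subset_closure

lemma measurableSet_strip : MeasurableSet strip := measurableSet_Ico.prod measurableSet_Ico

lemma isBounded_strip : Bornology.IsBounded strip :=
  (Metric.isBounded_Ico _ _).prod (Metric.isBounded_Ico _ _)

lemma IsFoldable.setIntegral_strip {F : ℝ × ℝ → ℂ} (hF : IsFoldable F) (hc : Continuous F) :
    ∫ p in strip, F p = 6 * ∫ p in TriDelta, F p := by
  rw [← integral_indicator measurableSet_strip, ← integral_indicator measurableSet_triDelta]
  refine hF.strip_eq_six_mul (fun G => ∫ p, G p) (fun G => Integrable G)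
    (integral_comp_of_involutive measurePreserving_reflOne reflOne_involutive)
    (integral_comp_of_involutive measurePreserving_reflTwo reflTwo_involutive)
    (integral_comp_of_involutive measurePreserving_reflThree reflThree_involutive)
    (fun G hG => measurePreserving_reflOne.integrable_comp_of_integrable hG)
    (fun G hG => measurePreserving_reflTwo.integrable_comp_of_integrable hG)
    (fun G hG => measurePreserving_reflThree.integrable_comp_of_integrable hG)
    (fun _ _ hG hH => hG.add hH) (fun _ _ hG hH => integral_add hG hH) ?_
  exact (integrable_indicator_iff measurableSet_triDelta).2
    (integrableOn_of_isBounded hc isBounded_triDelta)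

/-- The point `(a/n, b/n)` of the plane. -/
def gridPoint (n : ℕ) (a : ℤ × ℤ) : ℝ × ℝ := ((a.1 : ℝ) / n, (a.2 : ℝ) / n)

lemma gridPoint_mem_strip {n : ℕ} (hn : 1 ≤ n) (a : ℤ × ℤ) :
    gridPoint n a ∈ strip ↔ a ∈ Finset.Ico (0 : ℤ) (3 * n) ×ˢ Finset.Ico (0 : ℤ) n := by
  have hn' : (0 : ℝ) < n := by exact_mod_cast hn
  simp only [strip, gridPoint, Set.mem_prod, Set.mem_Ico, Finset.mem_product, Finset.mem_Ico,
    div_lt_iff₀ hn', le_div_iff₀ hn', zero_mul, one_mul]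
  norm_cast

lemma gridPoint_mem_triDelta {n : ℕ} (hn : 1 ≤ n) (a : ℤ × ℤ) :
    gridPoint n a ∈ TriDelta ↔ 0 ≤ a.1 ∧ 0 ≤ a.2 ∧ a.1 + a.2 ≤ n := by
  have hn' : (0 : ℝ) < n := by exact_mod_cast hn
  simp only [TriDelta, gridPoint, Set.mem_ofPred_eq, ← add_div,
    div_le_iff₀ hn', le_div_iff₀ hn', zero_mul, one_mul]
  norm_cast

/-- Sums over the grid are invariant under maps which permute the grid involutively. -/
lemma finsum_gridPoint_comp {n : ℕ} {r : ℝ × ℝ → ℝ × ℝ} (e : ℤ × ℤ → ℤ × ℤ)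
    (he : Function.Involutive e) (hr : ∀ a, r (gridPoint n a) = gridPoint n (e a))
    (G : ℝ × ℝ → ℂ) : ∑ᶠ a, (G ∘ r) (gridPoint n a) = ∑ᶠ a, G (gridPoint n a) := by
  simp only [Function.comp_apply, hr]
  exact finsum_comp_equiv he.toPerm (f := fun a => G (gridPoint n a))

lemma finite_support_gridPoint_comp {n : ℕ} {r : ℝ × ℝ → ℝ × ℝ} (e : ℤ × ℤ → ℤ × ℤ)
    (he : Function.Involutive e) (hr : ∀ a, r (gridPoint n a) = gridPoint n (e a))
    (G : ℝ × ℝ → ℂ) (hG : (Function.support fun a => G (gridPoint n a)).Finite) :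
    (Function.support fun a => (G ∘ r) (gridPoint n a)).Finite := by
  simp only [Function.comp_apply, hr]
  exact hG.preimage (f := e) he.injective.injOn

lemma IsFoldable.finsum_strip {n : ℕ} (hn : 1 ≤ n) {F : ℝ × ℝ → ℂ} (hF : IsFoldable F) :
    ∑ᶠ a, strip.indicator F (gridPoint n a) =
      6 * ∑ᶠ a, TriDelta.indicator F (gridPoint n a) := by
  have hn' : (n : ℝ) ≠ 0 := by positivity
  let e₁ : ℤ × ℤ → ℤ × ℤ := fun a => (-a.1, a.1 + a.2)
  let e₂ : ℤ × ℤ → ℤ × ℤ := fun a => (a.1 + a.2, -a.2)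
  let e₃ : ℤ × ℤ → ℤ × ℤ := fun a => (n - a.2, n - a.1)
  have i₁ : Function.Involutive e₁ := fun a => by simp [e₁]
  have i₂ : Function.Involutive e₂ := fun a => by simp [e₂]
  have i₃ : Function.Involutive e₃ := fun a => by simp [e₃]
  have h₁ : ∀ a, reflOne (gridPoint n a) = gridPoint n (e₁ a) := fun a => by
    ext <;> simp [e₁, reflOne, gridPoint] <;> ring
  have h₂ : ∀ a, reflTwo (gridPoint n a) = gridPoint n (e₂ a) := fun a => by
    ext <;> simp [e₂, reflTwo, gridPoint] <;> ring
  have h₃ : ∀ a, reflThree (gridPoint n a) = gridPoint n (e₃ a) := fun a => by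
    ext <;> simp [e₃, reflThree, gridPoint] <;> field_simp
  refine hF.strip_eq_six_mul (fun G => ∑ᶠ a, G (gridPoint n a))
    (fun G => (Function.support fun a => G (gridPoint n a)).Finite)
    (finsum_gridPoint_comp e₁ i₁ h₁) (finsum_gridPoint_comp e₂ i₂ h₂)
    (finsum_gridPoint_comp e₃ i₃ h₃) (finite_support_gridPoint_comp e₁ i₁ h₁)
    (finite_support_gridPoint_comp e₂ i₂ h₂) (finite_support_gridPoint_comp e₃ i₃ h₃)
    (fun G H hG hH => (hG.union hH).subset (Function.support_add _ _))
    (fun G H hG hH => finsum_add_distrib hG hH) ?_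
  refine (Set.finite_Icc (0 : ℤ × ℤ) (n, n)).subset fun a ha => ?_
  obtain ⟨h1, h2, h3⟩ := (gridPoint_mem_triDelta hn a).1 (Set.mem_of_indicator_ne_zero ha)
  exact ⟨⟨h1, h2⟩, by simp; omega, by simp; omega⟩

/-- Values on the sides of the triangle do not contribute. -/
lemma IsFoldable.finsum_triDelta {n : ℕ} (hn : 1 ≤ n) {F : ℝ × ℝ → ℂ} (hF : IsFoldable F) :
    ∑ᶠ a, TriDelta.indicator F (gridPoint n a) =
      ∑ᶠ a ∈ {a : ℤ × ℤ | 0 < a.1 ∧ 0 < a.2 ∧ a.1 + a.2 < n}, F (gridPoint n a) := by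
  have hn' : (n : ℝ) ≠ 0 := by positivity
  rw [finsum_mem_def]
  refine finsum_congr fun a => ?_
  simp only [Set.indicator_apply, gridPoint_mem_triDelta hn, Set.mem_ofPred_eq]
  by_cases h0 : F (gridPoint n a) = 0
  · simp [h0]
  have b0 : a.1 ≠ 0 := fun h => h0 (hF.left _ (by simp [gridPoint, h]))
  have b1 : a.2 ≠ 0 := fun h => h0 (hF.bottom _ (by simp [gridPoint, h]))
  have b2 : a.1 + a.2 ≠ n := fun h => h0 (hF.diagonal _ (by
    simp only [gridPoint, ← add_div]
    rw [div_eq_one_iff_eq hn']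
    exact_mod_cast h))
  congr 1
  apply propext
  omega

lemma phi_emb (h : ℤ × ℤ × ℤ) (p : ℝ × ℝ) :
    phi h (emb p) = Complex.exp (2 * π * Complex.I * (h.1 - h.2.2 : ℤ) * p.1 / 3) *
      Complex.exp (2 * π * Complex.I * (h.2.1 - h.2.2 : ℤ) * p.2 / 3) := by
  rw [← Complex.exp_add, phi, emb]
  push_cast
  ring_nf

lemma continuous_phi_emb (h : ℤ × ℤ × ℤ) : Continuous fun p => phi h (emb p) := by
  simp only [phi_emb]
  fun_prop

lemma phi_reflOne (h : ℤ × ℤ × ℤ) (p : ℝ × ℝ) :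
    phi h (emb (reflOne p)) = phi (-h.1, -h.2.2, -h.2.1) (emb p) := by
  simp only [phi, emb, reflOne]
  push_cast
  ring_nf

lemma phi_reflTwo (h : ℤ × ℤ × ℤ) (p : ℝ × ℝ) :
    phi h (emb (reflTwo p)) = phi (-h.2.2, -h.2.1, -h.1) (emb p) := by
  simp only [phi, emb, reflTwo]
  push_cast
  ring_nf

lemma phi_reflThree {h : ℤ × ℤ × ℤ} (hh : h.1 + h.2.1 + h.2.2 = 0) (p : ℝ × ℝ) :
    phi h (emb (reflThree p)) = phi (-h.2.1, -h.1, -h.2.2) (emb p) := by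
  have e : (h.1 : ℂ) = -h.2.1 - h.2.2 := by
    have : h.1 = -h.2.1 - h.2.2 := by omega
    rw [this]; push_cast; ring
  simp only [phi, emb, reflThree]
  rw [← Complex.exp_periodic.int_mul h.2.2 (_ / 3)]
  congr 1
  push_cast
  rw [e]
  ring

lemma isAlternating_tSin {k : ℤ × ℤ × ℤ} (hk : k.1 + k.2.1 + k.2.2 = 0) :
    IsAlternating fun p => TSin k (emb p) where
  one p := by
    simp only [TSin, phi_reflOne, neg_neg]
    ring
  two p := by
    simp only [TSin, phi_reflTwo, neg_neg]
    ring
  three p := by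
    simp only [TSin]
    rw [phi_reflThree, phi_reflThree, phi_reflThree, phi_reflThree, phi_reflThree, phi_reflThree]
    · simp only [neg_neg]
      ring
    all_goals first | omega | (simp only; omega)

lemma isAlternating_of_mem_span {n : ℕ} {f : ℝ × ℝ × ℝ → ℂ}
    (hf : f ∈ Submodule.span ℂ {F | ∃ k ∈ LamnCirc n, F = TSin k}) :
    IsAlternating fun p => f (emb p) := by
  induction hf using Submodule.span_induction with
  | mem f hf =>
    obtain ⟨k, hk, rfl⟩ := hf
    exact isAlternating_tSin hk.1
  | zero => constructor <;> simp
  | add f g _ _ hf hg =>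
    exact ⟨fun p => by simp [hf.one, hg.one, add_comm], fun p => by simp [hf.two, hg.two, add_comm],
      fun p => by simp [hf.three, hg.three, add_comm]⟩
  | smul c f _ hf =>
    exact ⟨fun p => by simp [hf.one], fun p => by simp [hf.two], fun p => by simp [hf.three]⟩

/-- The span of the exponentials with frequencies in a hexagon of size `n`. -/
def hexSpan (n : ℕ) : Submodule ℂ (ℝ × ℝ × ℝ → ℂ) :=
  Submodule.span ℂ {F | ∃ h : ℤ × ℤ × ℤ, h.1 + h.2.1 + h.2.2 = 0 ∧ |h.1| < n ∧ |h.2.1| < n ∧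
    |h.2.2| < n ∧ F = phi h}

lemma phi_mem_hexSpan {n : ℕ} {h : ℤ × ℤ × ℤ} (h0 : h.1 + h.2.1 + h.2.2 = 0) (h1 : |h.1| < n)
    (h2 : |h.2.1| < n) (h3 : |h.2.2| < n) : phi h ∈ hexSpan n :=
  Submodule.subset_span ⟨h, h0, h1, h2, h3, rfl⟩

lemma tSin_mem_hexSpan {n : ℕ} {k : ℤ × ℤ × ℤ} (hk : k ∈ LamnCirc n) : TSin k ∈ hexSpan n := by
  obtain ⟨h0, h1, h2, h3⟩ := hk
  have e : TSin k = (1 / (6 * Complex.I)) • (phi k + phi (k.2.1, k.2.2, k.1) +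
      phi (k.2.2, k.1, k.2.1) - phi (-k.1, -k.2.2, -k.2.1) - phi (-k.2.1, -k.1, -k.2.2) -
      phi (-k.2.2, -k.2.1, -k.1)) := rfl
  have b1 : |k.1| < n := by rw [abs_lt]; omega
  have b2 : |k.2.1| < n := by rw [abs_lt]; omega
  have b3 : |k.2.2| < n := by rw [abs_lt]; omega
  rw [e]
  refine Submodule.smul_mem _ _ (Submodule.sub_mem _ (Submodule.sub_mem _ (Submodule.sub_mem _
    (Submodule.add_mem _ (Submodule.add_mem _ ?_ ?_) ?_) ?_) ?_) ?_)
  all_goals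
    apply phi_mem_hexSpan
    · first | omega | (simp only; omega)
    all_goals simpa only [abs_neg]

lemma span_tSin_le_hexSpan (n : ℕ) :
    Submodule.span ℂ {F | ∃ k ∈ LamnCirc n, F = TSin k} ≤ hexSpan n := by
  rw [Submodule.span_le]
  rintro _ ⟨k, hk, rfl⟩
  exact tSin_mem_hexSpan hk

lemma phi_mul_conj_phi (a b : ℤ × ℤ × ℤ) (t : ℝ × ℝ × ℝ) :
    phi a t * (starRingEnd ℂ) (phi b t) = phi (a - b) t := by
  rw [phi, phi, phi, ← Complex.exp_conj, ← Complex.exp_add]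
  congr 1
  simp only [map_div₀, map_mul, map_add, Complex.conj_I, Complex.conj_ofReal, map_ofNat,
    map_intCast, Prod.fst_sub, Prod.snd_sub]
  push_cast
  ring

lemma mul_conj_mem_hexSpan {n : ℕ} {f g : ℝ × ℝ × ℝ → ℂ} (hf : f ∈ hexSpan n)
    (hg : g ∈ hexSpan n) : (fun t => f t * (starRingEnd ℂ) (g t)) ∈ hexSpan (2 * n) := by
  induction hf using Submodule.span_induction with
  | zero =>
    convert (hexSpan (2 * n)).zero_mem using 1
    funext t
    simp
  | add f₁ f₂ _ _ h₁ h₂ =>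
    convert (hexSpan (2 * n)).add_mem h₁ h₂ using 1
    funext t
    simp [add_mul]
  | smul c f _ h =>
    convert (hexSpan (2 * n)).smul_mem c h using 1
    funext t
    simp [mul_assoc]
  | mem f hf =>
    obtain ⟨a, a0, a1, a2, a3, rfl⟩ := hf
    induction hg using Submodule.span_induction with
    | zero =>
      convert (hexSpan (2 * n)).zero_mem using 1
      funext t
      simp
    | add g₁ g₂ _ _ h₁ h₂ =>
      convert (hexSpan (2 * n)).add_mem h₁ h₂ using 1
      funext t
      simp [mul_add]
    | smul c g _ h =>
      convert (hexSpan (2 * n)).smul_mem ((starRingEnd ℂ) c) h using 1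
      funext t
      simp [mul_left_comm]
    | mem g hg =>
      obtain ⟨b, b0, b1, b2, b3, rfl⟩ := hg
      simp only [phi_mul_conj_phi]
      rw [abs_lt] at a1 a2 a3 b1 b2 b3
      apply phi_mem_hexSpan
      · simp only [Prod.fst_sub, Prod.snd_sub]
        omega
      all_goals
        simp only [Prod.fst_sub, Prod.snd_sub, abs_lt]
        push_cast
        omega

lemma continuous_of_mem_hexSpan {n : ℕ} {F : ℝ × ℝ × ℝ → ℂ} (hF : F ∈ hexSpan n) :
    Continuous fun p => F (emb p) := by
  induction hF using Submodule.span_induction with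
  | mem f hf =>
    obtain ⟨h, -, -, -, -, rfl⟩ := hf
    exact continuous_phi_emb h
  | zero => exact continuous_const
  | add f g _ _ hf hg => exact hf.add hg
  | smul c f _ hf => exact hf.const_smul c

lemma exp_two_pi_mul_I_mul_int (m : ℤ) : Complex.exp (2 * π * Complex.I * m) = 1 := by
  rw [mul_comm, Complex.exp_int_mul_two_pi_mul_I]

/-- The integral of a nontrivial character over the circle `ℝ/Tℤ`. -/
lemma setIntegral_exp_eq_zero {m : ℤ} (hm : m ≠ 0) {T : ℝ} (hT : 0 < T) :
    ∫ x in Set.Ico 0 T, Complex.exp (2 * π * Complex.I * m * x / T) = 0 := by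
  have hT' : (T : ℂ) ≠ 0 := by exact_mod_cast hT.ne'
  have hm' : (m : ℂ) ≠ 0 := by exact_mod_cast hm
  have hc : 2 * π * Complex.I * m / T ≠ 0 := by
    refine div_ne_zero (mul_ne_zero Complex.two_pi_I_ne_zero hm') hT'
  rw [integral_Ico_eq_integral_Ioc, ← intervalIntegral.integral_of_le hT.le]
  have := integral_exp_mul_complex (a := 0) (b := T) hc
  simp only [div_mul_eq_mul_div] at this
  rw [this, mul_div_assoc, div_self hT', mul_one, exp_two_pi_mul_I_mul_int]
  simp

/-- The sum of a nontrivial character over the cyclic group `ℤ/Nℤ`. -/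
lemma sum_exp_eq_zero {m : ℤ} {N : ℕ} (hN : N ≠ 0) (hm : ¬(N : ℤ) ∣ m) :
    ∑ a ∈ Finset.Ico (0 : ℤ) N, Complex.exp (2 * π * Complex.I * m * a / N) = 0 := by
  have hN' : (N : ℂ) ≠ 0 := by exact_mod_cast hN
  set z := Complex.exp (2 * π * Complex.I * m / N) with hz
  have e : ∑ a ∈ Finset.Ico (0 : ℤ) N, Complex.exp (2 * π * Complex.I * m * a / N) =
      ∑ a ∈ Finset.range N, z ^ a := by
    refine Finset.sum_nbij' Int.toNat (fun a => (a : ℤ)) ?_ ?_ ?_ ?_ ?_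
    · intro a; simp only [Finset.mem_Ico, Finset.mem_range]; omega
    · intro a; simp
    · intro a; simp only [Finset.mem_Ico]; omega
    · intro a; simp
    · intro a ha
      lift a to ℕ using (Finset.mem_Ico.1 ha).1
      rw [hz, ← Complex.exp_nat_mul]
      simp only [Int.toNat_natCast, Int.cast_natCast]
      congr 1
      ring
  have h1 : z ≠ 1 := by
    rw [hz, Ne, Complex.exp_eq_one_iff]
    rintro ⟨q, hq⟩
    apply hm
    refine ⟨q, ?_⟩
    have : (m : ℂ) = N * q := by
      field_simp at hq
      linear_combination hq
    exact_mod_cast this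
  rw [e, geom_sum_eq h1, hz, ← Complex.exp_nat_mul, mul_div_cancel₀ _ hN',
    exp_two_pi_mul_I_mul_int]
  simp

lemma setIntegral_strip_mul (u v : ℝ → ℂ) :
    ∫ p in strip, u p.1 * v p.2 = (∫ x in Set.Ico 0 3, u x) * ∫ y in Set.Ico 0 1, v y :=
  setIntegral_prod_mul u v _ _

lemma finsum_indicator_strip {n : ℕ} (hn : 1 ≤ n) (F : ℝ × ℝ → ℂ) :
    ∑ᶠ a, strip.indicator F (gridPoint n a) =
      ∑ a ∈ Finset.Ico (0 : ℤ) (3 * n) ×ˢ Finset.Ico (0 : ℤ) n, F (gridPoint n a) := by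
  rw [finsum_eq_sum_of_support_subset (s := Finset.Ico (0 : ℤ) (3 * n) ×ˢ Finset.Ico (0 : ℤ) n)]
  · exact Finset.sum_congr rfl fun a ha =>
      Set.indicator_of_mem ((gridPoint_mem_strip hn a).2 ha) F
  · intro a ha
    exact (gridPoint_mem_strip hn a).1 (Set.mem_of_indicator_ne_zero ha)

lemma setIntegral_strip_phi_eq_zero {h : ℤ × ℤ × ℤ} (h0 : h.1 + h.2.1 + h.2.2 = 0) (hh : h ≠ 0) :
    ∫ p in strip, phi h (emb p) = 0 := by
  simp only [phi_emb]
  rw [setIntegral_strip_mul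
    (fun x => Complex.exp (2 * π * Complex.I * (h.1 - h.2.2 : ℤ) * x / 3))
    (fun y => Complex.exp (2 * π * Complex.I * (h.2.1 - h.2.2 : ℤ) * y / 3))]
  by_cases hm : h.1 - h.2.2 = 0
  · have h3 : h.2.2 ≠ 0 := fun h3 => hh (by ext <;> simp <;> omega)
    have e : h.2.1 - h.2.2 = 3 * -h.2.2 := by omega
    have := setIntegral_exp_eq_zero (neg_ne_zero.2 h3) one_pos
    rw [e]
    convert mul_zero _ using 2
    rw [← this]
    congr 1
    funext y
    congr 1
    push_cast
    ring
  · have := setIntegral_exp_eq_zero hm (T := 3) (by norm_num)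
    rw [Complex.ofReal_ofNat] at this
    rw [this, zero_mul]

lemma sum_strip_phi_eq_zero {n : ℕ} (hn : 1 ≤ n) {h : ℤ × ℤ × ℤ} (h0 : h.1 + h.2.1 + h.2.2 = 0)
    (h1 : |h.1| < (2 * n : ℕ)) (h2 : |h.2.1| < (2 * n : ℕ)) (h3 : |h.2.2| < (2 * n : ℕ))
    (hh : h ≠ 0) :
    ∑ a ∈ Finset.Ico (0 : ℤ) (3 * n) ×ˢ Finset.Ico (0 : ℤ) n, phi h (emb (gridPoint n a)) = 0 := by
  have hn' : (n : ℂ) ≠ 0 := by exact_mod_cast (by omega : n ≠ 0)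
  have key : ∀ a : ℤ × ℤ, phi h (emb (gridPoint n a)) =
      Complex.exp (2 * π * Complex.I * (h.1 - h.2.2 : ℤ) * a.1 / (3 * n : ℕ)) *
      Complex.exp (2 * π * Complex.I * (h.2.1 - h.2.2 : ℤ) * a.2 / (3 * n : ℕ)) := fun a => by
    rw [phi_emb, gridPoint]
    push_cast
    congr 2 <;> field_simp
  simp only [key]
  rw [Finset.sum_product]
  simp only [← Finset.sum_mul_sum]
  by_cases hm : ((3 * n : ℕ) : ℤ) ∣ h.1 - h.2.2
  · obtain ⟨q, hq⟩ := hm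
    push_cast at hq
    have hq' : h.1 - h.2.2 = 3 * (n * q) := by rw [hq]; ring
    have e : h.2.1 - h.2.2 = 3 * (-h.2.2 - n * q) := by omega
    have hd : ¬(n : ℤ) ∣ -h.2.2 - n * q := by
      rintro ⟨r, hr⟩
      have e3 : h.2.2 = n * (-q - r) := by linear_combination -hr
      have e1 : h.1 = n * (2 * q - r) := by linear_combination hq' + e3
      have e2 : h.2.1 = n * (2 * r - q) := by linear_combination h0 - e1 - e3
      have hpos : (0 : ℤ) < n := by omega
      have bound : ∀ s : ℤ, |n * s| < (2 * n : ℕ) → -2 < s ∧ s < 2 := fun s hs => by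
        push_cast at hs
        rw [abs_mul, Nat.abs_cast, mul_comm (2 : ℤ), mul_lt_mul_iff_right₀ hpos] at hs
        exact abs_lt.1 hs
      have := bound _ (e1 ▸ h1)
      have := bound _ (e2 ▸ h2)
      have := bound _ (e3 ▸ h3)
      have hq0 : q = 0 := by omega
      have hr0 : r = 0 := by omega
      subst hq0 hr0
      exact hh (by ext <;> simp [e1, e2, e3])
    have := sum_exp_eq_zero (by omega : n ≠ 0) hd
    rw [e]
    convert mul_zero _ using 2
    rw [← this]
    refine Finset.sum_congr rfl fun a _ => ?_
    congr 1
    push_cast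
    field_simp
  · have := sum_exp_eq_zero (by omega : 3 * n ≠ 0) hm
    rw [Nat.cast_mul, Nat.cast_ofNat] at this
    rw [this, zero_mul]

lemma phi_zero (t : ℝ × ℝ × ℝ) : phi 0 t = 1 := by
  simp [phi]

/-- The cubature rule on the strip is exact for exponentials with small frequencies. -/
lemma setIntegral_strip_eq_sum {n : ℕ} (hn : 1 ≤ n) {F : ℝ × ℝ × ℝ → ℂ}
    (hF : F ∈ hexSpan (2 * n)) :
    (n : ℂ) ^ 2 * ∫ p in strip, F (emb p) =
      ∑ a ∈ Finset.Ico (0 : ℤ) (3 * n) ×ˢ Finset.Ico (0 : ℤ) n, F (emb (gridPoint n a)) := by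
  induction hF using Submodule.span_induction with
  | mem f hf =>
    obtain ⟨h, h0, h1, h2, h3, rfl⟩ := hf
    by_cases hh : h = 0
    · subst hh
      have := setIntegral_strip_mul (fun _ => 1) (fun _ => 1)
      simp only [mul_one] at this
      have hN : (3 * (n : ℤ)).toNat = 3 * n := by omega
      simp only [phi_zero, this]
      simp [hN]
      ring
    · rw [setIntegral_strip_phi_eq_zero h0 hh, sum_strip_phi_eq_zero hn h0 h1 h2 h3 hh, mul_zero]
  | zero => simp
  | add f g hf hg ihf ihg =>
    simp only [Pi.add_apply]
    rw [integral_add (integrableOn_of_isBounded (continuous_of_mem_hexSpan hf) isBounded_strip)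
      (integrableOn_of_isBounded (continuous_of_mem_hexSpan hg) isBounded_strip), mul_add, ihf, ihg,
      Finset.sum_add_distrib]
  | smul c f _ ih =>
    simp only [Pi.smul_apply, smul_eq_mul]
    rw [integral_const_mul, mul_left_comm, ih, Finset.mul_sum]

lemma finsum_lamnCirc {n : ℕ} (F : ℝ × ℝ × ℝ → ℂ) :
    ∑ᶠ j ∈ LamnCirc n, F (pt n j) =
      ∑ᶠ a ∈ {a : ℤ × ℤ | 0 < a.1 ∧ 0 < a.2 ∧ a.1 + a.2 < n}, F (emb (gridPoint n a)) := by
  symm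
  refine finsum_mem_eq_of_bijOn (fun a => (a.1, a.2, -a.1 - a.2)) ⟨?_, ?_, ?_⟩ ?_
  · rintro ⟨a, b⟩ ⟨h1, h2, h3⟩
    simp only at h1 h2 h3
    exact ⟨by simp only; omega, h1, h2, by simp only; omega⟩
  · rintro ⟨a, b⟩ _ ⟨c, d⟩ _ h
    simp only [Prod.mk.injEq] at h
    simp [h.1, h.2.1]
  · rintro ⟨a, b, c⟩ ⟨h0, h1, h2, h3⟩
    simp only at h0 h1 h2 h3
    refine ⟨(a, b), ⟨h1, h2, by simp only; omega⟩, ?_⟩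
    simp only [Prod.mk.injEq, true_and]
    omega
  · rintro ⟨a, b⟩ _
    congr 1
    simp only [pt, emb, gridPoint, Prod.mk.injEq, true_and]
    push_cast
    ring

theorem stmt_12 (n : ℕ) (hn : 1 ≤ n) (f g : ℝ × ℝ × ℝ → ℂ)
    (hf : f ∈ Submodule.span ℂ {F | ∃ k ∈ LamnCirc n, F = TSin k})
    (hg : g ∈ Submodule.span ℂ {F | ∃ k ∈ LamnCirc n, F = TSin k}) :
    innerD f g =
      ((2 / (n : ℝ) ^ 2 : ℝ) : ℂ) *
        ∑ᶠ j ∈ LamnCirc n, f (pt n j) * (starRingEnd ℂ) (g (pt n j)) := by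
  have hn' : (n : ℂ) ≠ 0 := by exact_mod_cast (by omega : n ≠ 0)
  have hF := (isAlternating_of_mem_span hf).isFoldable_mul_conj (isAlternating_of_mem_span hg)
  have hmem := mul_conj_mem_hexSpan (span_tSin_le_hexSpan n hf) (span_tSin_le_hexSpan n hg)
  have hint := hF.setIntegral_strip (continuous_of_mem_hexSpan hmem)
  have hsum := hF.finsum_strip hn
  rw [finsum_indicator_strip hn, hF.finsum_triDelta hn] at hsum
  have hcub := setIntegral_strip_eq_sum hn hmem
  rw [hint, hsum] at hcub
  rw [innerD, finsum_lamnCirc fun t => f t * (starRingEnd ℂ) (g t)]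
  push_cast
  rw [div_mul_eq_mul_div, eq_div_iff (pow_ne_zero 2 hn')]
  linear_combination hcub / 3
end
end

section
/- Let n ≥ 1. For every function f in the complex linear span of {TC_k : k ∈ Λ_{2n−1}}, the cubature formula 2 ∫_Δ f(t₁, t₂, −t₁−t₂) dt₁dt₂ = (1/(3n²)) Σ_{j ∈ Λ_n} λ_j^{(n)} f(j₁/n, j₂/n, j₃/n) holds; i.e. the cubature with nodes {j/n : j ∈ Λ_n} and weights λ_j^{(n)}/(3n²) is exact on the space spanned by the generalized cosines TC_k of degree −k₃ at most 2n−1. -/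
open MeasureTheory
open scoped Real Classical

noncomputable section

lemma phi_eq_exp_mul {k k' : ℤ × ℤ × ℤ} {t t' : ℝ × ℝ × ℝ} (d m : ℤ)
    (h : (k.1 : ℝ) * t.1 + k.2.1 * t.2.1 + k.2.2 * t.2.2 =
      k'.1 * t'.1 + k'.2.1 * t'.2.1 + k'.2.2 * t'.2.2 + d + 3 * m) :
    phi k t = Complex.exp (2 * Real.pi * Complex.I * d / 3) * phi k' t' := by
  have h' := congrArg (fun x : ℝ => (x : ℂ)) h
  push_cast at h'
  rw [phi, phi, ← Complex.exp_add, Complex.exp_eq_exp_iff_exists_int]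
  exact ⟨m, by rw [h']; ring⟩

lemma TCos_emb_reflect {k : ℤ × ℤ × ℤ} (hk : k.1 + k.2.1 + k.2.2 = 0) (x y : ℝ) :
    TCos k (emb (1 - y, 1 - x)) = TCos k (emb (x, y)) := by
  obtain ⟨p, q, r⟩ := k
  simp only at hk
  have key : ∀ a b c : ℤ, a + b + c = 0 →
      phi (a, b, c) (emb (1 - y, 1 - x)) = phi (-b, -a, -c) (emb (x, y)) := by
    intro a b c h
    have h' : (a : ℝ) + b + c = 0 := by exact_mod_cast h
    rw [phi_eq_exp_mul (k' := (-b, -a, -c)) (t' := emb (x, y)) 0 (-c)]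
    · simp
    · simp only [emb]
      push_cast
      linear_combination h'
  simp only [TCos]
  rw [key p q r hk, key q r p (by omega), key r p q (by omega), key (-p) (-r) (-q) (by omega),
    key (-q) (-p) (-r) (by omega), key (-r) (-q) (-p) (by omega)]
  simp only [neg_neg]
  ring

lemma TCos_emb_rotate {k : ℤ × ℤ × ℤ} (hk : k.1 + k.2.1 + k.2.2 = 0) (x y : ℝ) :
    TCos k (emb (1 - x - y, x)) =
      Complex.exp (2 * Real.pi * Complex.I * (k.1 - k.2.2 : ℤ) / 3) * TCos k (emb (x, y)) := by
  obtain ⟨p, q, r⟩ := k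
  simp only at hk ⊢
  have key : ∀ a b c m : ℤ, a - c = p - r + 3 * m →
      phi (a, b, c) (emb (1 - x - y, x)) =
        Complex.exp (2 * Real.pi * Complex.I * (p - r : ℤ) / 3) * phi (b, c, a) (emb (x, y)) := by
    intro a b c m h
    have h' : (a : ℝ) - c = p - r + 3 * m := by exact_mod_cast h
    refine phi_eq_exp_mul (p - r) m ?_
    simp only [emb]
    push_cast
    linear_combination h'
  simp only [TCos]
  rw [key p q r 0 (by omega), key q r p (-p) (by omega), key r p q r (by omega),
    key (-p) (-r) (-q) (-p) (by omega), key (-q) (-p) (-r) r (by omega),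
    key (-r) (-q) (-p) 0 (by omega)]
  ring

lemma continuous_TCos_emb (k : ℤ × ℤ × ℤ) : Continuous fun p => TCos k (emb p) := by
  unfold TCos phi emb
  fun_prop

/-- If `k₁ ≡ k₃` and `k₂ ≡ k₃` modulo `3`, then `φ_k` is a pure wave with integer frequencies. -/
lemma phi_emb_eq {p q r A B : ℤ} (hA : p - r = 3 * A) (hB : q - r = 3 * B) (x y : ℝ) :
    phi (p, q, r) (emb (x, y)) =
      Complex.exp (2 * Real.pi * Complex.I * A * x) *
        Complex.exp (2 * Real.pi * Complex.I * B * y) := by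
  have hA' : (p : ℂ) - r = 3 * A := by exact_mod_cast hA
  have hB' : (q : ℂ) - r = 3 * B := by exact_mod_cast hB
  rw [phi, ← Complex.exp_add]
  congr 1
  simp only [emb]
  push_cast
  linear_combination (2 * Real.pi * Complex.I / 3 * x) * hA' +
    (2 * Real.pi * Complex.I / 3 * y) * hB'

lemma setIntegral_exp_Icc_eq_zero {A : ℤ} (hA : A ≠ 0) :
    ∫ x in Set.Icc (0 : ℝ) 1, Complex.exp (2 * Real.pi * Complex.I * A * x) = 0 := by
  rw [integral_Icc_eq_integral_Ioc, ← intervalIntegral.integral_of_le zero_le_one,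
    integral_exp_mul_complex]
  · have : Complex.exp (2 * Real.pi * Complex.I * A * (1 : ℝ)) = 1 :=
      Complex.exp_eq_one_iff.2 ⟨A, by push_cast; ring⟩
    rw [this]
    simp
  · have : (Real.pi : ℂ) ≠ 0 := by exact_mod_cast Real.pi_ne_zero
    have : (A : ℂ) ≠ 0 := by exact_mod_cast hA
    simp_all [Complex.I_ne_zero]

lemma sum_exp_Ico_eq_zero {n : ℕ} (hn : 1 ≤ n) {A : ℤ} (hA : ¬ (n : ℤ) ∣ A) :
    ∑ x ∈ Finset.Ico (0 : ℤ) n,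
      Complex.exp (2 * Real.pi * Complex.I * A * ((x : ℝ) / n : ℝ)) = 0 := by
  have hn0 : (n : ℂ) ≠ 0 := by exact_mod_cast (by omega : n ≠ 0)
  set z := Complex.exp (2 * Real.pi * Complex.I * A / n) with hz
  have h1 : z ≠ 1 := by
    intro h
    obtain ⟨m, hm⟩ := Complex.exp_eq_one_iff.1 h
    have hpi : (2 * Real.pi * Complex.I : ℂ) ≠ 0 := Complex.two_pi_I_ne_zero
    rw [div_eq_iff hn0] at hm
    have : (A : ℂ) = n * m := mul_left_cancel₀ hpi (by linear_combination hm)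
    exact hA ⟨m, by exact_mod_cast this⟩
  have h2 : z ^ n = 1 := by
    rw [hz, ← Complex.exp_nat_mul]
    exact Complex.exp_eq_one_iff.2 ⟨A, by field_simp⟩
  have h3 : ∑ x ∈ Finset.Ico (0 : ℤ) n,
      Complex.exp (2 * Real.pi * Complex.I * A * ((x : ℝ) / n : ℝ)) =
        ∑ i ∈ Finset.range n, z ^ i := by
    symm
    refine Finset.sum_nbij' (fun i : ℕ => (i : ℤ)) Int.toNat ?_ ?_ ?_ ?_ ?_
    · intro i hi
      simp only [Finset.mem_range, Finset.mem_Ico] at *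
      omega
    · intro i hi
      simp only [Finset.mem_range, Finset.mem_Ico] at *
      omega
    · intro i hi
      simp
    · intro i hi
      simp only [Finset.mem_Ico] at hi
      simp [hi.1]
    · intro i hi
      rw [hz, ← Complex.exp_nat_mul]
      congr 1
      push_cast
      ring
  rw [h3, geom_sum_eq h1, h2]
  simp

lemma setIntegral_square_phi_eq_zero {p q r : ℤ} (hs : p + q + r = 0) (h3 : (3 : ℤ) ∣ p - r)
    (h0 : ¬ (p = 0 ∧ q = 0)) :
    ∫ z in Set.Icc (0 : ℝ) 1 ×ˢ Set.Icc (0 : ℝ) 1, phi (p, q, r) (emb z) = 0 := by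
  obtain ⟨A, hA⟩ := h3
  obtain ⟨B, hB⟩ : ∃ B, q - r = 3 * B := ⟨-r - A, by omega⟩
  have : ∀ z : ℝ × ℝ, phi (p, q, r) (emb z) =
      Complex.exp (2 * Real.pi * Complex.I * A * z.1) *
        Complex.exp (2 * Real.pi * Complex.I * B * z.2) := fun z => phi_emb_eq hA hB z.1 z.2
  simp only [this]
  rw [Measure.volume_eq_prod, setIntegral_prod_mul
    (fun x : ℝ => Complex.exp (2 * Real.pi * Complex.I * A * x))
    (fun y : ℝ => Complex.exp (2 * Real.pi * Complex.I * B * y))]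
  by_cases hA0 : A = 0
  · rw [setIntegral_exp_Icc_eq_zero (A := B) (by omega), mul_zero]
  · rw [setIntegral_exp_Icc_eq_zero hA0, zero_mul]

lemma sum_square_phi_eq_zero {n : ℕ} (hn : 1 ≤ n) {p q r : ℤ} (hs : p + q + r = 0)
    (h3 : (3 : ℤ) ∣ p - r) (h0 : ¬ (3 * (n : ℤ) ∣ p - r ∧ 3 * (n : ℤ) ∣ q - r)) :
    ∑ z ∈ Finset.Ico (0 : ℤ) n ×ˢ Finset.Ico (0 : ℤ) n,
      phi (p, q, r) (emb ((z.1 : ℝ) / n, (z.2 : ℝ) / n)) = 0 := by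
  obtain ⟨A, hA⟩ := h3
  obtain ⟨B, hB⟩ : ∃ B, q - r = 3 * B := ⟨-r - A, by omega⟩
  simp only [phi_emb_eq hA hB]
  rw [Finset.sum_product]
  dsimp only
  rw [← Finset.sum_mul_sum]
  rw [hA, hB, mul_dvd_mul_iff_left three_ne_zero, mul_dvd_mul_iff_left three_ne_zero] at h0
  by_cases hA0 : (n : ℤ) ∣ A
  · rw [sum_exp_Ico_eq_zero hn (A := B) (by tauto), mul_zero]
  · rw [sum_exp_Ico_eq_zero hn hA0, zero_mul]

lemma setIntegral_square_TCos_eq_zero {k : ℤ × ℤ × ℤ} (hs : k.1 + k.2.1 + k.2.2 = 0)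
    (h3 : (3 : ℤ) ∣ k.1 - k.2.2) (h0 : k ≠ 0) :
    ∫ z in Set.Icc (0 : ℝ) 1 ×ˢ Set.Icc (0 : ℝ) 1, TCos k (emb z) = 0 := by
  obtain ⟨p, q, r⟩ := k
  simp only [ne_eq, Prod.mk_eq_zero] at hs h3 h0
  have hi : ∀ j, Integrable (fun z => phi j (emb z))
      (volume.restrict (Set.Icc (0 : ℝ) 1 ×ˢ Set.Icc (0 : ℝ) 1)) := by
    intro j
    refine ContinuousOn.integrableOn_compact (isCompact_Icc.prod isCompact_Icc) ?_
    unfold phi emb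
    fun_prop
  simp only [TCos]
  rw [integral_const_mul, integral_add (by fun_prop) (hi _), integral_add (by fun_prop) (hi _),
    integral_add (by fun_prop) (hi _), integral_add (by fun_prop) (hi _),
    integral_add (hi _) (hi _)]
  rw [setIntegral_square_phi_eq_zero, setIntegral_square_phi_eq_zero,
    setIntegral_square_phi_eq_zero, setIntegral_square_phi_eq_zero,
    setIntegral_square_phi_eq_zero, setIntegral_square_phi_eq_zero]
  · simp
  all_goals omega

lemma sum_square_TCos_eq_zero {n : ℕ} (hn : 1 ≤ n) {k : ℤ × ℤ × ℤ}
    (hs : k.1 + k.2.1 + k.2.2 = 0) (h3 : (3 : ℤ) ∣ k.1 - k.2.2)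
    (h0 : ¬ (3 * (n : ℤ) ∣ k.1 - k.2.2 ∧ 3 * (n : ℤ) ∣ k.2.1 - k.2.2)) :
    ∑ z ∈ Finset.Ico (0 : ℤ) n ×ˢ Finset.Ico (0 : ℤ) n,
      TCos k (emb ((z.1 : ℝ) / n, (z.2 : ℝ) / n)) = 0 := by
  obtain ⟨p, q, r⟩ := k
  simp only at hs h3 h0
  have key : ∀ a b c : ℤ, 3 * (n : ℤ) ∣ a → 3 * (n : ℤ) ∣ b → c = a - b →
      3 * (n : ℤ) ∣ c := fun a b c ha hb hc => hc ▸ dvd_sub ha hb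
  have key' : ∀ a b : ℤ, 3 * (n : ℤ) ∣ a → b = -a → 3 * (n : ℤ) ∣ b :=
    fun a b ha hb => hb ▸ (dvd_neg.2 ha)
  simp only [TCos]
  rw [← Finset.mul_sum]
  simp only [Finset.sum_add_distrib]
  rw [sum_square_phi_eq_zero hn, sum_square_phi_eq_zero hn, sum_square_phi_eq_zero hn,
    sum_square_phi_eq_zero hn, sum_square_phi_eq_zero hn, sum_square_phi_eq_zero hn]
  · simp
  any_goals omega
  all_goals
    rintro ⟨h1, h2⟩
    refine h0 ⟨?_, ?_⟩ <;>
    first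
    | convert h1 using 1; omega
    | convert h2 using 1; omega
    | exact key' _ _ h1 (by omega)
    | exact key' _ _ h2 (by omega)
    | exact key _ _ _ h1 h2 (by omega)
    | exact key _ _ _ h2 h1 (by omega)

lemma measurePreserving_reflect :
    MeasurePreserving (fun z : ℝ × ℝ => (1 - z.2, 1 - z.1)) := by
  have h := Measure.measurePreserving_sub_left (volume : Measure ℝ) 1
  exact (h.prod h).comp Measure.measurePreserving_swap

lemma measurePreserving_rotate :
    MeasurePreserving (fun z : ℝ × ℝ => (1 - z.1 - z.2, z.1)) := by
  have h := Measure.measurePreserving_sub_left (volume : Measure ℝ) 1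
  have := Measure.measurePreserving_swap.comp (((MeasurePreserving.id volume).prod h).comp
    (measurePreserving_prod_add (volume : Measure ℝ) (volume : Measure ℝ)))
  simpa only [Function.comp_def, Prod.map, Prod.swap, id, sub_sub, ← Measure.volume_eq_prod] using this

lemma measurableEmbedding_reflect :
    MeasurableEmbedding (fun z : ℝ × ℝ => (1 - z.2, 1 - z.1)) := by
  refine Continuous.measurableEmbedding (by fun_prop) fun a b h => ?_
  simp only [Prod.mk.injEq] at h
  ext <;> linarith [h.1, h.2]

lemma measurableEmbedding_rotate :
    MeasurableEmbedding (fun z : ℝ × ℝ => (1 - z.1 - z.2, z.1)) := by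
  refine Continuous.measurableEmbedding (by fun_prop) fun a b h => ?_
  simp only [Prod.mk.injEq] at h
  ext <;> linarith [h.1, h.2]

lemma setIntegral_TriDelta_comp_rotate (g : ℝ × ℝ → ℂ) :
    ∫ z in TriDelta, g (1 - z.1 - z.2, z.1) = ∫ z in TriDelta, g z := by
  rw [← measurePreserving_rotate.setIntegral_preimage_emb measurableEmbedding_rotate g TriDelta]
  congr 2
  ext z
  simp only [TriDelta, Set.mem_ofPred_eq, Set.mem_preimage]
  constructor <;> rintro ⟨h1, h2, h3⟩ <;> refine ⟨?_, ?_, ?_⟩ <;> linarith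

lemma isClosed_TriDelta : IsClosed TriDelta := by
  have h : TriDelta = {z : ℝ × ℝ | 0 ≤ z.1} ∩ ({z | 0 ≤ z.2} ∩ {z | z.1 + z.2 ≤ 1}) := by
    ext z
    simp [TriDelta]
  rw [h]
  exact (isClosed_le (by fun_prop) (by fun_prop)).inter
    ((isClosed_le (by fun_prop) (by fun_prop)).inter (isClosed_le (by fun_prop) (by fun_prop)))

lemma TriDelta_subset_square : TriDelta ⊆ Set.Icc (0 : ℝ) 1 ×ˢ Set.Icc (0 : ℝ) 1 := by
  rintro ⟨x, y⟩ ⟨h1, h2, h3⟩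
  simp only at h1 h2 h3
  exact ⟨⟨h1, by simp only; linarith⟩, ⟨h2, by simp only; linarith⟩⟩

lemma isCompact_TriDelta : IsCompact TriDelta :=
  (isCompact_Icc.prod isCompact_Icc).of_isClosed_subset isClosed_TriDelta TriDelta_subset_square

lemma volume_line_eq_zero : volume {z : ℝ × ℝ | z.1 + z.2 = 1} = 0 := by
  have hm : MeasurableSet {z : ℝ × ℝ | z.1 + z.2 = 1} :=
    (isClosed_eq (by fun_prop) (by fun_prop)).measurableSet
  rw [Measure.volume_eq_prod, Measure.measure_prod_null hm]
  refine Filter.Eventually.of_forall fun x => ?_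
  have : Prod.mk x ⁻¹' {z : ℝ × ℝ | z.1 + z.2 = 1} = {1 - x} := by
    ext y
    simp only [Set.mem_preimage, Set.mem_ofPred_eq, Set.mem_singleton_iff]
    constructor <;> intro h <;> linarith
  simp [this]

lemma two_mul_setIntegral_TriDelta {g : ℝ × ℝ → ℂ} (hg : Continuous g)
    (hr : ∀ x y, g (1 - y, 1 - x) = g (x, y)) :
    2 * ∫ z in TriDelta, g z = ∫ z in Set.Icc (0 : ℝ) 1 ×ˢ Set.Icc (0 : ℝ) 1, g z := by
  have hsq : IntegrableOn g (Set.Icc (0 : ℝ) 1 ×ˢ Set.Icc (0 : ℝ) 1) :=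
    hg.continuousOn.integrableOn_compact (isCompact_Icc.prod isCompact_Icc)
  have hd := setIntegral_sdiff isClosed_TriDelta.measurableSet hsq TriDelta_subset_square
  have hrefl : ∫ z in (Set.Icc (0 : ℝ) 1 ×ˢ Set.Icc (0 : ℝ) 1) \ TriDelta, g z =
      ∫ z in TriDelta, g z := by
    calc _ = ∫ z in (fun z : ℝ × ℝ => (1 - z.2, 1 - z.1)) ⁻¹'
              (TriDelta \ {z : ℝ × ℝ | z.1 + z.2 = 1}), g (1 - z.2, 1 - z.1) := by
            simp only [hr]
            congr 2
            ext ⟨x, y⟩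
            simp only [TriDelta, Set.mem_sdiff, Set.mem_prod, Set.mem_Icc, Set.mem_ofPred_eq,
              Set.mem_preimage]
            constructor
            · rintro ⟨⟨⟨h1, h2⟩, h3, h4⟩, h5⟩
              have h6 : 1 < x + y := by
                by_contra h
                exact h5 ⟨h1, h3, not_lt.1 h⟩
              exact ⟨⟨by linarith, by linarith, by linarith⟩, by intro h; linarith⟩
            · rintro ⟨⟨h1, h2, h3⟩, h4⟩
              refine ⟨⟨⟨by linarith, by linarith⟩, by linarith, by linarith⟩, ?_⟩
              rintro ⟨h5, h6, h7⟩
              exact h4 (by linarith)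
      _ = ∫ z in TriDelta \ {z : ℝ × ℝ | z.1 + z.2 = 1}, g z :=
            measurePreserving_reflect.setIntegral_preimage_emb measurableEmbedding_reflect g _
      _ = _ := setIntegral_congr_set (sdiff_null_ae_eq_self volume_line_eq_zero)
  linear_combination hd - hrefl

/-- The first two coordinates of the points of `Λ_n`. -/
def triGrid (n : ℕ) : Finset (ℤ × ℤ) :=
  (Finset.Icc (0 : ℤ) n ×ˢ Finset.Icc (0 : ℤ) n).filter fun z => z.1 + z.2 ≤ n

lemma mem_triGrid {n : ℕ} {z : ℤ × ℤ} :
    z ∈ triGrid n ↔ 0 ≤ z.1 ∧ 0 ≤ z.2 ∧ z.1 + z.2 ≤ n := by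
  simp only [triGrid, Finset.mem_filter, Finset.mem_product, Finset.mem_Icc]
  omega

lemma finsum_mem_Lamn (n : ℕ) (g : ℤ × ℤ × ℤ → ℂ) :
    ∑ᶠ j ∈ Lamn n, g j = ∑ z ∈ triGrid n, g (z.1, z.2, -z.1 - z.2) := by
  rw [← finsum_mem_coe_finset]
  symm
  refine finsum_mem_eq_of_bijOn (fun z : ℤ × ℤ => (z.1, z.2, -z.1 - z.2)) ⟨?_, ?_, ?_⟩ ?_
  · intro z hz
    have := mem_triGrid.1 (Finset.mem_coe.1 hz)
    simp only [Lamn, Set.mem_ofPred_eq]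
    omega
  · intro a _ b _ h
    simp only [Prod.mk.injEq] at h
    exact Prod.ext h.1 h.2.1
  · rintro ⟨a, b, c⟩ h
    simp only [Lamn, Set.mem_ofPred_eq] at h
    refine ⟨(a, b), ?_, ?_⟩
    · rw [Finset.mem_coe, mem_triGrid]
      simp only
      omega
    · simp only [Prod.mk.injEq, true_and]
      omega
  · intro z _
    rfl

lemma sum_triGrid_comp_rotate (n : ℕ) (g : ℤ × ℤ → ℂ) :
    ∑ z ∈ triGrid n, g (n - z.1 - z.2, z.1) = ∑ z ∈ triGrid n, g z := by
  refine Finset.sum_nbij' (fun z => ((n : ℤ) - z.1 - z.2, z.1))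
    (fun z => (z.2, (n : ℤ) - z.1 - z.2)) ?_ ?_ ?_ ?_ ?_
  · intro z hz
    rw [mem_triGrid] at *
    simp only
    omega
  · intro z hz
    rw [mem_triGrid] at *
    simp only
    omega
  · intro z _
    ext <;> grind
  · intro z _
    ext <;> grind
  · intro z _
    rfl

/-- Multiplicity with which a point of the grid is covered by the half-open unit square folded
along its antidiagonal. -/
def foldMult (n : ℕ) (z : ℤ × ℤ) : ℂ :=
  (if z.1 + z.2 < n then 1 else 0) + (if 0 < z.1 ∧ 0 < z.2 then 1 else 0)

lemma lamwt_eq_foldMult {n : ℕ} (hn : 1 ≤ n) {z : ℤ × ℤ} (hz : z ∈ triGrid n) :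
    ((lamwt n (z.1, z.2, -z.1 - z.2) : ℝ) : ℂ) =
      foldMult n z + foldMult n (n - z.1 - z.2, z.1) + foldMult n (z.2, n - z.1 - z.2) := by
  obtain ⟨x, y⟩ := z
  rw [mem_triGrid] at hz
  simp only [lamwt, foldMult, Prod.mk.injEq] at *
  split_ifs <;> first | omega | norm_num

lemma sum_foldMult {n : ℕ} {g : ℤ × ℤ → ℂ} (hr : ∀ x y, g (n - y, n - x) = g (x, y)) :
    ∑ z ∈ triGrid n, foldMult n z * g z =
      ∑ z ∈ Finset.Ico (0 : ℤ) n ×ˢ Finset.Ico (0 : ℤ) n, g z := by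
  simp only [foldMult, add_mul, Finset.sum_add_distrib, ite_mul, one_mul, zero_mul]
  rw [← Finset.sum_filter, ← Finset.sum_filter,
    ← Finset.sum_filter_add_sum_filter_not (Finset.Ico (0 : ℤ) n ×ˢ Finset.Ico (0 : ℤ) n)
      (fun z => z.1 + z.2 < n)]
  congr 1
  · congr 1
    ext z
    simp only [Finset.mem_filter, mem_triGrid, Finset.mem_product, Finset.mem_Ico]
    omega
  · refine Finset.sum_nbij' (fun z => ((n : ℤ) - z.2, (n : ℤ) - z.1))
      (fun z => ((n : ℤ) - z.2, (n : ℤ) - z.1)) ?_ ?_ ?_ ?_ ?_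
    · intro z
      simp only [Finset.mem_filter, mem_triGrid, Finset.mem_product, Finset.mem_Ico]
      omega
    · intro z
      simp only [Finset.mem_filter, mem_triGrid, Finset.mem_product, Finset.mem_Ico]
      omega
    · intro z _
      ext <;> simp
    · intro z _
      ext <;> simp
    · intro z _
      exact (hr z.1 z.2).symm

/-- A weighted sum over the grid unfolds to a sum over the unit square, for functions that are
invariant under the reflection and equivariant under the rotation of the triangle. -/
lemma sum_lamwt_mul {n : ℕ} (hn : 1 ≤ n) {g : ℤ × ℤ → ℂ} {c : ℂ} (hc : c ^ 3 = 1)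
    (hr : ∀ x y, g (n - y, n - x) = g (x, y)) (hrot : ∀ x y, g (n - x - y, x) = c * g (x, y)) :
    ∑ z ∈ triGrid n, ((lamwt n (z.1, z.2, -z.1 - z.2) : ℝ) : ℂ) * g z =
      (1 + c + c ^ 2) *
        ∑ z ∈ Finset.Ico (0 : ℤ) n ×ˢ Finset.Ico (0 : ℤ) n, g z := by
  rw [← sum_foldMult hr]
  have h1 := sum_triGrid_comp_rotate n fun z => foldMult n z * g z
  have h2 := sum_triGrid_comp_rotate n
    fun z => foldMult n (n - z.1 - z.2, z.1) * g (n - z.1 - z.2, z.1)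
  simp only [hrot] at h1 h2
  have e : ∀ z : ℤ × ℤ, ((n : ℤ) - (n - z.1 - z.2) - z.1, (n : ℤ) - z.1 - z.2) =
      (z.2, (n : ℤ) - z.1 - z.2) := fun z => by ext <;> grind
  simp only [e] at h2
  rw [h1] at h2
  rw [Finset.sum_congr rfl fun z hz => by rw [lamwt_eq_foldMult hn hz]]
  simp only [add_mul, Finset.sum_add_distrib]
  have h1' : ∑ z ∈ triGrid n, foldMult n (n - z.1 - z.2, z.1) * g z =
      c ^ 2 * ∑ z ∈ triGrid n, foldMult n z * g z := by
    rw [← h1, Finset.mul_sum]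
    refine Finset.sum_congr rfl fun z _ => ?_
    linear_combination (-(foldMult n (n - z.1 - z.2, z.1) * g z)) * hc
  have h2' : ∑ z ∈ triGrid n, foldMult n (z.2, n - z.1 - z.2) * g z =
      c * ∑ z ∈ triGrid n, foldMult n z * g z := by
    rw [← h2, Finset.mul_sum]
    refine Finset.sum_congr rfl fun z _ => ?_
    linear_combination (-(foldMult n (z.2, n - z.1 - z.2) * g z)) * hc
  rw [h1', h2']
  ring

lemma not_dvd_of_mem_Lamn {n : ℕ} (hn : 1 ≤ n) {k : ℤ × ℤ × ℤ} (hk : k ∈ Lamn (2 * n - 1))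
    (h0 : k ≠ 0) : ¬ (3 * (n : ℤ) ∣ k.1 - k.2.2 ∧ 3 * (n : ℤ) ∣ k.2.1 - k.2.2) := by
  obtain ⟨p, q, r⟩ := k
  simp only [Lamn, Set.mem_ofPred_eq, ne_eq, Prod.mk_eq_zero] at hk h0 ⊢
  obtain ⟨hs, hp, hq, hr⟩ := hk
  rw [Nat.cast_sub (by omega)] at hr
  push_cast at hr
  rintro ⟨⟨u, hu⟩, ⟨v, hv⟩⟩
  have hn' : (1 : ℤ) ≤ n := by exact_mod_cast hn
  have bound : ∀ w : ℤ, 0 ≤ 3 * (n : ℤ) * w → 3 * (n : ℤ) * w < 6 * n → w = 0 ∨ w = 1 := by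
    intro w h1 h2
    have : 0 ≤ w := by
      by_contra h
      nlinarith
    have : w < 2 := by
      by_contra h
      nlinarith
    omega
  rcases bound u (by omega) (by omega) with rfl | rfl <;>
    rcases bound v (by omega) (by omega) with rfl | rfl <;> omega

lemma TCos_zero (t : ℝ × ℝ × ℝ) : TCos 0 t = 1 := by
  simp [TCos, phi]
  norm_num

lemma volume_real_TriDelta : volume.real TriDelta = 1 / 2 := by
  have h := two_mul_setIntegral_TriDelta (g := fun _ => 1) continuous_const fun _ _ => rfl
  simp only [setIntegral_const, Measure.volume_eq_prod, measureReal_prod_prod] at h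
  simp only [Real.volume_real_Icc] at h
  rw [← Measure.volume_eq_prod] at h
  norm_num at h
  have h' : 2 * volume.real TriDelta = 1 := by exact_mod_cast h
  linarith

lemma cubature_TCos {n : ℕ} (hn : 1 ≤ n) {k : ℤ × ℤ × ℤ} (hk : k ∈ Lamn (2 * n - 1)) :
    2 * ∫ z in TriDelta, TCos k (emb z) =
      ((1 / (3 * (n : ℝ) ^ 2) : ℝ) : ℂ) * ∑ z ∈ triGrid n,
        ((lamwt n (z.1, z.2, -z.1 - z.2) : ℝ) : ℂ) *
          TCos k (emb ((z.1 : ℝ) / n, (z.2 : ℝ) / n)) := by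
  have hs : k.1 + k.2.1 + k.2.2 = 0 := hk.1
  have hn0 : (n : ℝ) ≠ 0 := by exact_mod_cast (by omega : n ≠ 0)
  set c := Complex.exp (2 * Real.pi * Complex.I * (k.1 - k.2.2 : ℤ) / 3) with hc
  have hc3 : c ^ 3 = 1 := by
    rw [hc, ← Complex.exp_nat_mul]
    exact Complex.exp_eq_one_iff.2 ⟨k.1 - k.2.2, by push_cast; ring⟩
  rw [sum_lamwt_mul hn (g := fun z => TCos k (emb ((z.1 : ℝ) / n, (z.2 : ℝ) / n))) hc3]
  rotate_left
  · intro x y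
    rw [← TCos_emb_reflect hs]
    congr 2
    ext <;> simp [sub_div, hn0]
  · intro x y
    rw [hc, ← TCos_emb_rotate hs]
    congr 2
    ext <;> simp [sub_div, hn0]
  by_cases h0 : k = 0
  · subst h0
    have : c = 1 := by simp [hc]
    rw [this]
    simp only [TCos_zero, setIntegral_const, volume_real_TriDelta]
    have hn0' : (n : ℂ) ≠ 0 := by exact_mod_cast hn0
    simp
    field_simp
    norm_num
  by_cases h1 : c = 1
  · obtain ⟨m, hm⟩ := Complex.exp_eq_one_iff.1 h1
    have h3 : (3 : ℤ) ∣ k.1 - k.2.2 := by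
      refine ⟨m, ?_⟩
      have : ((k.1 - k.2.2 : ℤ) : ℂ) = 3 * m :=
        mul_left_cancel₀ Complex.two_pi_I_ne_zero (by linear_combination 3 * hm)
      exact_mod_cast this
    rw [sum_square_TCos_eq_zero hn hs h3 (not_dvd_of_mem_Lamn hn hk h0),
      two_mul_setIntegral_TriDelta (continuous_TCos_emb k) (TCos_emb_reflect hs),
      setIntegral_square_TCos_eq_zero hs h3 h0]
    simp
  · have h1' : c - 1 ≠ 0 := sub_ne_zero.2 h1
    have hsum : 1 + c + c ^ 2 = 0 := by
      refine mul_left_cancel₀ h1' ?_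
      linear_combination hc3
    have hint := setIntegral_TriDelta_comp_rotate fun z => TCos k (emb z)
    simp only [TCos_emb_rotate hs] at hint
    rw [integral_const_mul, ← hc] at hint
    have : ∫ z in TriDelta, TCos k (emb z) = 0 := by
      refine mul_left_cancel₀ h1' ?_
      linear_combination hint
    rw [this, hsum]
    simp

theorem stmt_13 (n : ℕ) (hn : 1 ≤ n) (f : ℝ × ℝ × ℝ → ℂ)
    (hf : f ∈ Submodule.span ℂ {F | ∃ k ∈ Lamn (2 * n - 1), F = TCos k}) :
    2 * ∫ p in TriDelta, f (emb p) =
      ((1 / (3 * (n : ℝ) ^ 2) : ℝ) : ℂ) *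
        ∑ᶠ j ∈ Lamn n, ((lamwt n j : ℝ) : ℂ) * f (pt n j) := by
  have hpt : ∀ z : ℤ × ℤ, pt n (z.1, z.2, -z.1 - z.2) = emb ((z.1 : ℝ) / n, (z.2 : ℝ) / n) := by
    intro z
    simp only [pt, emb]
    push_cast
    rw [sub_div, neg_div]
  rw [finsum_mem_Lamn]
  simp only [hpt]
  refine (Submodule.span_induction (p := fun f _ =>
    IntegrableOn (fun z => f (emb z)) TriDelta ∧ 2 * ∫ z in TriDelta, f (emb z) =
      ((1 / (3 * (n : ℝ) ^ 2) : ℝ) : ℂ) * ∑ z ∈ triGrid n,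
        ((lamwt n (z.1, z.2, -z.1 - z.2) : ℝ) : ℂ) *
          f (emb ((z.1 : ℝ) / n, (z.2 : ℝ) / n))) ?_ ?_ ?_ ?_ hf).2
  · rintro _ ⟨k, hk, rfl⟩
    exact ⟨(continuous_TCos_emb k).continuousOn.integrableOn_compact isCompact_TriDelta,
      cubature_TCos hn hk⟩
  · simp [IntegrableOn]
  · rintro f g _ _ ⟨hf, hf'⟩ ⟨hg, hg'⟩
    refine ⟨hf.add hg, ?_⟩
    simp only [Pi.add_apply, mul_add, Finset.sum_add_distrib]
    rw [integral_add hf hg, mul_add, hf', hg']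
  · rintro a f _ ⟨hf, hf'⟩
    refine ⟨hf.const_mul a, ?_⟩
    simp only [Pi.smul_apply, smul_eq_mul, mul_left_comm _ a, ← Finset.mul_sum]
    rw [integral_const_mul, mul_left_comm, hf']
end
end

section
/- Let z(t) = TC_{(0,1,−1)}(t) = (1/3)[exp(2πi(t₂−t₃)/3) + exp(2πi(t₁−t₂)/3) + exp(2πi(t₃−t₁)/3)]. Then for every m ≥ 1, every k with 1 ≤ k ≤ m−1, and every t ∈ ℝ³_H: (1) TC_{(k, m+1−k, −m−1)}(t) = 3·z(t)·TC_{(k, m−k, −m)}(t) − TC_{(k+1, m−k−1, −m)}(t) − TC_{(k−1, m−k, −m+1)}(t); (2) TS_{(k+1, m−k+2, −m−3)}(t) = 3·z(t)·TS_{(k+1, m−k+1, −m−2)}(t) − TS_{(k+2, m−k, −m−2)}(t) − TS_{(k, m−k+1, −m−1)}(t); and (3) for 0 ≤ k ≤ m, TC_{(m−k, k, −m)}(t) = conj(TC_{(k, m−k, −m)}(t)). -/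
open MeasureTheory
open scoped Real Classical

noncomputable section

theorem phi_mul (a b c a' b' c' : ℤ) (t : ℝ × ℝ × ℝ) :
    phi (a, b, c) t * phi (a', b', c') t = phi (a + a', b + b', c + c') t := by
  simp only [phi, ← Complex.exp_add]
  push_cast
  congr 1
  ring

theorem conj_phi (a b c : ℤ) (t : ℝ × ℝ × ℝ) :
    (starRingEnd ℂ) (phi (a, b, c) t) = phi (-a, -b, -c) t := by
  simp only [phi, ← Complex.exp_conj, map_mul, map_add, map_div₀, Complex.conj_I,
    Complex.conj_ofReal, map_intCast, map_ofNat]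
  push_cast
  congr 1
  ring

theorem TCos_zero_one_neg_one (t : ℝ × ℝ × ℝ) :
    TCos (0, 1, -1) t = (1 / 3) * (phi (0, 1, -1) t + phi (1, -1, 0) t + phi (-1, 0, 1) t) := by
  simp only [TCos, neg_neg, neg_zero]
  ring

/-- Multiplication by `3z` shifts the index of a generalized cosine by the three steps
`(0, 1, -1)`, `(1, -1, 0)` and `(-1, 0, 1)`. -/
theorem three_mul_TCos_mul_TCos (a b c : ℤ) (t : ℝ × ℝ × ℝ) :
    3 * TCos (0, 1, -1) t * TCos (a, b, c) t =
      TCos (a, b + 1, c - 1) t + TCos (a + 1, b - 1, c) t + TCos (a - 1, b, c + 1) t := by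
  rw [TCos_zero_one_neg_one]
  simp only [TCos]
  ring_nf
  simp only [phi_mul]
  ring_nf

/-- Multiplication by `3z` shifts the index of a generalized sine by the three steps
`(0, 1, -1)`, `(1, -1, 0)` and `(-1, 0, 1)`. -/
theorem three_mul_TCos_mul_TSin (a b c : ℤ) (t : ℝ × ℝ × ℝ) :
    3 * TCos (0, 1, -1) t * TSin (a, b, c) t =
      TSin (a, b + 1, c - 1) t + TSin (a + 1, b - 1, c) t + TSin (a - 1, b, c + 1) t := by
  rw [TCos_zero_one_neg_one]
  simp only [TSin]
  rw [mul_left_comm, ← mul_add, ← mul_add]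
  congr 1
  ring_nf
  simp only [phi_mul]
  ring_nf

/-- Swapping the first two entries of the index conjugates a generalized cosine. -/
theorem TCos_swap (a b c : ℤ) (t : ℝ × ℝ × ℝ) :
    TCos (b, a, c) t = (starRingEnd ℂ) (TCos (a, b, c) t) := by
  simp only [TCos, map_mul, map_add, map_div₀, map_one, map_ofNat, conj_phi, neg_neg]
  ring

theorem stmt_17 (m : ℕ) (hm : 1 ≤ m) (t : ℝ × ℝ × ℝ)
    (ht : t.1 + t.2.1 + t.2.2 = 0) :
    -- z(t) = TC_{(0,1,-1)}(t) is the stated sum of three exponentials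
    TCos (0, 1, -1) t =
      (1 / 3) * (Complex.exp (2 * (Real.pi : ℂ) * Complex.I * ((t.2.1 - t.2.2 : ℝ) : ℂ) / 3) +
        Complex.exp (2 * (Real.pi : ℂ) * Complex.I * ((t.1 - t.2.1 : ℝ) : ℂ) / 3) +
        Complex.exp (2 * (Real.pi : ℂ) * Complex.I * ((t.2.2 - t.1 : ℝ) : ℂ) / 3)) ∧
    (∀ k : ℕ, 1 ≤ k → k ≤ m - 1 →
      -- (1) recursion for the generalized cosines
      (TCos ((k : ℤ), (m : ℤ) + 1 - k, -(m : ℤ) - 1) t =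
        3 * TCos (0, 1, -1) t * TCos ((k : ℤ), (m : ℤ) - k, -(m : ℤ)) t -
          TCos ((k : ℤ) + 1, (m : ℤ) - k - 1, -(m : ℤ)) t -
          TCos ((k : ℤ) - 1, (m : ℤ) - k, -(m : ℤ) + 1) t) ∧
      -- (2) recursion for the generalized sines
      (TSin ((k : ℤ) + 1, (m : ℤ) - k + 2, -(m : ℤ) - 3) t =
        3 * TCos (0, 1, -1) t * TSin ((k : ℤ) + 1, (m : ℤ) - k + 1, -(m : ℤ) - 2) t -
          TSin ((k : ℤ) + 2, (m : ℤ) - k, -(m : ℤ) - 2) t -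
          TSin ((k : ℤ), (m : ℤ) - k + 1, -(m : ℤ) - 1) t)) ∧
    -- (3) conjugation symmetry
    (∀ k : ℕ, k ≤ m →
      TCos ((m : ℤ) - k, (k : ℤ), -(m : ℤ)) t =
        (starRingEnd ℂ) (TCos ((k : ℤ), (m : ℤ) - k, -(m : ℤ)) t)) := by
  refine ⟨?_, fun k _ _ => ⟨?_, ?_⟩, fun k _ => TCos_swap _ _ _ t⟩
  · rw [TCos_zero_one_neg_one]
    simp only [phi]
    push_cast
    ring_nf
  · rw [three_mul_TCos_mul_TCos]
    ring_nf
  · rw [three_mul_TCos_mul_TSin]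
    ring_nf
end
end
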